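/- Let H₁ and H₂ be n×n complex Hermitian matrices and let u : ℝ → ℂⁿ be differentiable with u′(t) = (H₁ + iH₂)·u(t) for all t. Define v : ℝ × ℝ → ℂⁿ by v(t,p) = e^{−p}·u(t). Then for all (t,p), the partial derivative of v in t satisfies ∂ₜv(t,p) = −H₁·(∂ₚv)(t,p) + i·H₂·v(t,p). -/

import Mathlib

open Matrix

/-- The warped phase transformation: if `u' = (H₁ + i H₂) u` with `H₁, H₂`
Hermitian, then `v(t,p) = e^{-p} u(t)` satisfies `∂ₜ v = -H₁ ∂ₚ v + i H₂ v`. -/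
theorem fractional_stmt6 {n : ℕ} (H₁ H₂ : Matrix (Fin n) (Fin n) ℂ)
    (hH₁ : H₁.IsHermitian) (hH₂ : H₂.IsHermitian)
    (u : ℝ → (Fin n → ℂ))
    (hu : ∀ t : ℝ, HasDerivAt u ((H₁ + Complex.I • H₂) *ᵥ u t) t)
    (v : ℝ → ℝ → (Fin n → ℂ))
    (hv : v = fun t p => (Real.exp (-p) : ℂ) • u t) :
    ∀ t p : ℝ,
      HasDerivAt (fun s : ℝ => v s p)
        (-(H₁ *ᵥ deriv (fun q : ℝ => v t q) p) + Complex.I • (H₂ *ᵥ v t p)) t := by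
  subst hv
  intro t p
  have hp : HasDerivAt (fun q : ℝ => (Real.exp (-q) : ℂ) • u t)
      (-((Real.exp (-p) : ℂ) • u t)) p := by
    have h := ((hasDerivAt_neg p).exp.ofReal_comp).smul_const (u t)
    simpa using h
  beta_reduce
  rw [hp.deriv]
  have ht := (hu t).const_smul (Real.exp (-p) : ℂ)
  refine ht.congr_deriv ?_
  simp only [mulVec_neg, neg_neg, add_mulVec, smul_mulVec, mulVec_smul, smul_add]
  rw [smul_comm Complex.I]
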